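/- arXiv:2604.04301 — 5 statements merged into one kernel-verified Lean document; each statement's English description precedes it below -/
import Mathlib

section
/- Let X ⊆ ℝ^n be closed with nonempty interior, Y ⊆ ℝ^m nonempty and open, Φ : X × Y → ℝ continuous relative to X × Y, and f : X → ℝ ∪ {±∞} lower semicontinuous. Then the graph of the Φ-subdifferential ∂_Φ f is closed in X × Y: if x^ν → x̄ with x^ν, x̄ ∈ X, y^ν ∈ ∂_Φ f(x^ν) for all ν, and y^ν → ȳ ∈ Y, then ȳ ∈ ∂_Φ f(x̄). -/
set_option linter.unusedVariables false

open Filter Topology Metric Set Bornology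
open scoped RealInnerProductSpace NNReal

noncomputable section

variable {E F : Type*} [NormedAddCommGroup E] [InnerProductSpace ℝ E] [CompleteSpace E]
  [NormedAddCommGroup F] [InnerProductSpace ℝ F] [CompleteSpace F]

/-- Gradient of the coupling `Φ` in its first argument. -/
def gradx (Φ : E → F → ℝ) (x : E) (y : F) : E :=
  gradient (fun x' => Φ x' y) x

/-- Gradient of the coupling `Φ` in its second argument. -/
def grady (Φ : E → F → ℝ) (x : E) (y : F) : F :=
  gradient (fun y' => Φ x y') y

/-- The Φ-conjugate of `f` relative to `X`: `f^Φ(y) = sup_{x ∈ X} (Φ(x,y) − f(x))`. -/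
def phiConj (X : Set E) (Φ : E → F → ℝ) (f : E → EReal) (y : F) : EReal :=
  ⨆ x ∈ X, ((Φ x y : EReal) - f x)

/-- The Φ-biconjugate of `f`: `f^{ΦΦ}(x) = sup_{y ∈ Y} (Φ(x,y) − f^Φ(y))`. -/
def phiBiconj (X : Set E) (Y : Set F) (Φ : E → F → ℝ) (f : E → EReal) (x : E) : EReal :=
  ⨆ y ∈ Y, ((Φ x y : EReal) - phiConj X Φ f y)

/-- `f` is Φ-convex on `X`: `f` is a pointwise supremum over `X` of functions
`x ↦ Φ(x, yᵢ) − βᵢ` with `yᵢ ∈ Y` (the empty index set giving `f ≡ −∞`). -/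
def PhiConvexOn (X : Set E) (Y : Set F) (Φ : E → F → ℝ) (f : E → EReal) : Prop :=
  ∃ (ι : Type) (yi : ι → F) (βi : ι → EReal),
    (∀ i, yi i ∈ Y) ∧ ∀ x ∈ X, f x = ⨆ i, ((Φ x (yi i) : EReal) - βi i)

/-- The Φ-subdifferential of `f` at `xb`:
`y ∈ ∂_Φ f(xb)` iff `y ∈ Y` and `f(x) ≥ f(xb) + Φ(x,y) − Φ(xb,y)` for all `x ∈ X`. -/
def phiSubdiff (X : Set E) (Y : Set F) (Φ : E → F → ℝ) (f : E → EReal) (xb : E) : Set F :=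
  {y | y ∈ Y ∧ ∀ x ∈ X, f xb + ((Φ x y - Φ xb y : ℝ) : EReal) ≤ f x}

/-- The Φ-subdifferential of a function `gc` on `Y` (such as `f^Φ`) at `yb`:
`x ∈ ∂_Φ gc(yb)` iff `x ∈ X` and `gc(y) ≥ gc(yb) + Φ(x,y) − Φ(x,yb)` for all `y ∈ Y`. -/
def phiSubdiffDual (X : Set E) (Y : Set F) (Φ : E → F → ℝ) (gc : F → EReal) (yb : F) : Set E :=
  {x | x ∈ X ∧ ∀ y ∈ Y, gc yb + ((Φ x y - Φ x yb : ℝ) : EReal) ≤ gc y}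

/-- The generalized proximal mapping `(∂_Φ g)^{-1}(y) = argmin_{x ∈ X} (g(x) − Φ(x,y))`. -/
def proxSet (X : Set E) (Φ : E → F → ℝ) (g : E → EReal) (y : F) : Set E :=
  {x | x ∈ X ∧ ∀ x' ∈ X, g x - ((Φ x y : ℝ) : EReal) ≤ g x' - ((Φ x' y : ℝ) : EReal)}

/-- Assumption (G): `g` is proper and lsc on `X`, `g − Φ(·,y)` is level-bounded in `x`
locally uniformly in `y`, and the range of the generalized proximal mapping lies in `int X`. -/
structure AssumptionG (X : Set E) (Y : Set F) (Φ : E → F → ℝ) (g : E → EReal) : Prop where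
  proper : ∃ x ∈ X, g x ≠ ⊤
  ne_bot : ∀ x, g x ≠ ⊥
  lsc : LowerSemicontinuousOn g X
  levelBounded : ∀ yb ∈ Y, ∀ α : ℝ, ∃ V ∈ 𝓝 yb, ∃ B : Set E, IsBounded B ∧
    ∀ y ∈ V ∩ Y, {x | x ∈ X ∧ g x - ((Φ x y : ℝ) : EReal) ≤ (α : EReal)} ⊆ B
  ran_interior : ∀ y ∈ Y, proxSet X Φ g y ⊆ interior X

/-- `v` is a regular (Fréchet) subgradient of `f` at `x`. -/
def IsFSubgrad (f : E → EReal) (x v : E) : Prop :=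
  f x ≠ ⊤ ∧ f x ≠ ⊥ ∧ ∀ ε > (0 : ℝ), ∃ δ > (0 : ℝ), ∀ x', ‖x' - x‖ < δ →
    f x + ((⟪v, x' - x⟫ - ε * ‖x' - x‖ : ℝ) : EReal) ≤ f x'

/-- `v` is a limiting (Mordukhovich) subgradient of `f` at `x`. -/
def IsLSubgrad (f : E → EReal) (x v : E) : Prop :=
  f x ≠ ⊤ ∧ f x ≠ ⊥ ∧ ∃ xs vs : ℕ → E,
    Tendsto xs atTop (𝓝 x) ∧ Tendsto (fun ν => f (xs ν)) atTop (𝓝 (f x)) ∧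
    Tendsto vs atTop (𝓝 v) ∧ ∀ ν, IsFSubgrad f (xs ν) (vs ν)

/-- `f` is locally lower semicontinuous at `xb`. -/
def LocallyLscAt (f : E → EReal) (xb : E) : Prop :=
  ∃ ε > (0 : ℝ), ∀ α : EReal, α ≤ f xb + ((ε : ℝ) : EReal) →
    IsClosed {x | x ∈ closedBall xb ε ∧ f x ≤ α}

/-- `g` is prox-regular at `xb` for `vb` with parameter `r`. -/
def ProxRegularAt (g : E → EReal) (xb vb : E) (r : ℝ) : Prop :=
  g xb ≠ ⊤ ∧ g xb ≠ ⊥ ∧ LocallyLscAt g xb ∧ IsLSubgrad g xb vb ∧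
  ∃ ε > (0 : ℝ), ∀ x x' v : E, ‖x' - xb‖ ≤ ε → ‖x - xb‖ ≤ ε →
    g x ≤ g xb + ((ε : ℝ) : EReal) → IsLSubgrad g x v → ‖v - vb‖ ≤ ε →
    g x + ((⟪v, x' - x⟫ - r / 2 * ‖x' - x‖ ^ 2 : ℝ) : EReal) ≤ g x'

/-- `g` is Φ-prox-regular at `xb` for `(vb, yb)`. -/
def PhiProxRegularAt (X : Set E) (Φ : E → F → ℝ) (g : E → EReal)
    (xb vb : E) (yb : F) : Prop :=
  g xb ≠ ⊤ ∧ g xb ≠ ⊥ ∧ LocallyLscAt g xb ∧ IsLSubgrad g xb vb ∧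
  ∃ ε > (0 : ℝ), ∀ (x x' v : E) (y : F), ‖x' - xb‖ ≤ ε → ‖x - xb‖ ≤ ε →
    g x - g xb ≤ ((ε : ℝ) : EReal) → IsLSubgrad g x v → ‖v - vb‖ ≤ ε → ‖y - yb‖ ≤ ε →
    v = gradx Φ x y →
    g x + ((Φ x' y - Φ x y : ℝ) : EReal) ≤ g x'

/-- `g` is Φ-prox-regular at `xb` for `(vb, yb)` with the subgradient inequality strict
whenever `x' ≠ x`. -/
def PhiProxRegularStrictAt (X : Set E) (Φ : E → F → ℝ) (g : E → EReal)
    (xb vb : E) (yb : F) : Prop :=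
  PhiProxRegularAt X Φ g xb vb yb ∧
  ∃ ε > (0 : ℝ), ∀ (x x' v : E) (y : F), ‖x' - xb‖ ≤ ε → ‖x - xb‖ ≤ ε →
    g x - g xb ≤ ((ε : ℝ) : EReal) → IsLSubgrad g x v → ‖v - vb‖ ≤ ε → ‖y - yb‖ ≤ ε →
    v = gradx Φ x y → x' ≠ x →
    g x + ((Φ x' y - Φ x y : ℝ) : EReal) < g x'

/-- The `g`-attentive `ε`-localization of the limiting subdifferential `∂g` at `xb` for `vb`. -/
def gAttentiveLoc (g : E → EReal) (xb vb : E) (ε : ℝ) (x : E) : Set E :=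
  {v | ‖x - xb‖ < ε ∧ g x < g xb + ((ε : ℝ) : EReal) ∧ IsLSubgrad g x v ∧ ‖v - vb‖ < ε}

/-- `Φ` is twist: for each `x ∈ int X` the map `y ↦ ∇ₓΦ(x,y)` is injective on `Y`. -/
def IsTwist (X : Set E) (Y : Set F) (Φ : E → F → ℝ) : Prop :=
  ∀ x ∈ interior X, Set.InjOn (fun y => gradx Φ x y) Y

/-- `Φ` is a local strong twist at `(xb, yb)`: with `vb := ∇ₓΦ(xb,yb)` there is a unique
continuously differentiable map `G(x,v)` near `(xb,vb)`, with values in `Y`, such that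
`G(xb,vb) = yb` and `∇ₓΦ(x, G(x,v)) = v` near `(xb,vb)`. -/
def IsLocalStrongTwist (Y : Set F) (Φ : E → F → ℝ) (xb : E) (yb : F) : Prop :=
  ∃ (G : E × E → F) (U : Set (E × E)), IsOpen U ∧ (xb, gradx Φ xb yb) ∈ U ∧
    ContDiffOn ℝ 1 G U ∧ G (xb, gradx Φ xb yb) = yb ∧ (∀ p ∈ U, G p ∈ Y) ∧
    (∀ p ∈ U, gradx Φ p.1 (G p) = p.2) ∧
    ∀ (G' : E × E → F) (U' : Set (E × E)), IsOpen U' → (xb, gradx Φ xb yb) ∈ U' →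
      ContDiffOn ℝ 1 G' U' → G' (xb, gradx Φ xb yb) = yb → (∀ p ∈ U', G' p ∈ Y) →
      (∀ p ∈ U', gradx Φ p.1 (G' p) = p.2) →
      ∀ᶠ p in 𝓝 (xb, gradx Φ xb yb), G' p = G p

/-- `Φ` is a global strong twist. -/
def IsGlobalStrongTwist (X : Set E) (Y : Set F) (Φ : E → F → ℝ) : Prop :=
  IsTwist X Y Φ ∧ ∀ xb ∈ interior X, ∀ yb ∈ Y, IsLocalStrongTwist Y Φ xb yb

/-- `σ` is a single-valued localization of the set-valued map `Fm` around `pb` for `qb`,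
with domain of localization `U`. -/
def IsSVLocalization {α β : Type*} [TopologicalSpace α] [TopologicalSpace β]
    (Fm : α → Set β) (pb : α) (qb : β) (σ : α → β) (U : Set α) : Prop :=
  U ∈ 𝓝 pb ∧ σ pb = qb ∧ ∃ V ∈ 𝓝 qb, ∀ p ∈ U, Fm p ∩ V = {σ p}

/-- `H` is a first-order approximation to `Fm` at `xb`. -/
def IsFOApprox {α β : Type*} [NormedAddCommGroup α] [NormedAddCommGroup β]
    (Fm H : α → β) (xb : α) : Prop :=
  H xb = Fm xb ∧ ∀ ε > (0 : ℝ), ∃ V ∈ 𝓝 xb, ∀ x ∈ V, ‖Fm x - H x‖ ≤ ε * ‖x - xb‖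

/-- `H` is a strict first-order approximation to `Fm` at `xb`. -/
def IsStrictFOApprox {α β : Type*} [NormedAddCommGroup α] [NormedAddCommGroup β]
    (Fm H : α → β) (xb : α) : Prop :=
  H xb = Fm xb ∧ ∀ ε > (0 : ℝ), ∃ V ∈ 𝓝 xb, ∀ x ∈ V, ∀ x' ∈ V,
    ‖Fm x - H x - (Fm x' - H x')‖ ≤ ε * ‖x - x'‖

/-- Sequential epi-convergence of `fs` to `f`. -/
def EpiConvergesSeq (fs : ℕ → E → EReal) (f : E → EReal) : Prop :=
  ∀ w : E,
    (∀ ws : ℕ → E, Tendsto ws atTop (𝓝 w) →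
      f w ≤ Filter.liminf (fun ν => fs ν (ws ν)) atTop) ∧
    (∃ ws : ℕ → E, Tendsto ws atTop (𝓝 w) ∧
      Filter.limsup (fun ν => fs ν (ws ν)) atTop ≤ f w)

/-- `g` is strictly twice epi-differentiable at `xb` for `vb`: the second-order difference
quotients epi-converge to a common limit along every sequence `tₙ ↘ 0`,
`(xₙ, vₙ) → (xb, vb)` with `vₙ ∈ ∂g(xₙ)` and `g(xₙ) → g(xb)`. -/
def StrictTwiceEpiDiff (g : E → EReal) (xb vb : E) : Prop :=
  ∃ h : E → EReal, ∀ (ts : ℕ → ℝ) (xs vs : ℕ → E),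
    (∀ ν, 0 < ts ν) → Tendsto ts atTop (𝓝 0) →
    Tendsto xs atTop (𝓝 xb) → Tendsto vs atTop (𝓝 vb) →
    (∀ ν, IsLSubgrad g (xs ν) (vs ν)) →
    Tendsto (fun ν => g (xs ν)) atTop (𝓝 (g xb)) →
    EpiConvergesSeq (fun ν w =>
      ((2 / (ts ν) ^ 2 : ℝ) : EReal) *
        (g (xs ν + ts ν • w) - g (xs ν) - ((ts ν * ⟪vs ν, w⟫ : ℝ) : EReal))) h

/-- `g` is prox-bounded with threshold `lamg`. -/
def ProxBoundedWith (g : E → EReal) (lamg : ℝ) : Prop :=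
  ∀ lam : ℝ, 0 < lam → lam < lamg → ∃ (y : E) (b : ℝ), ∀ x : E,
    (b : EReal) ≤ g x + ((1 / (2 * lam) * ‖x - y‖ ^ 2 : ℝ) : EReal)

/-- `φ` is lower-C¹ on the open set `O`: locally a max over a compact index set `Z`
of functions `h(x, ·)` that are continuous in `(x,y)` together with their `y`-gradients. -/
def LowerC1On (φ : F → ℝ) (O : Set F) : Prop :=
  ∀ y₀ ∈ O, ∃ (V : Set F) (Z : Set E) (h : E → F → ℝ) (hy : E → F → F),
    V ∈ 𝓝 y₀ ∧ IsCompact Z ∧ Z.Nonempty ∧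
    ContinuousOn (fun p : E × F => h p.1 p.2) (Z ×ˢ V) ∧
    ContinuousOn (fun p : E × F => hy p.1 p.2) (Z ×ˢ V) ∧
    (∀ x ∈ Z, ∀ y ∈ V, HasGradientAt (h x) (hy x y) y) ∧
    ∀ y ∈ V, (∃ x ∈ Z, φ y = h x y) ∧ ∀ x ∈ Z, h x y ≤ φ y

theorem phi_subdifferential_graph_closed {n m : ℕ}
    (X : Set (EuclideanSpace ℝ (Fin n))) (Y : Set (EuclideanSpace ℝ (Fin m)))
    (Φ : EuclideanSpace ℝ (Fin n) → EuclideanSpace ℝ (Fin m) → ℝ)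
    (hXcl : IsClosed X) (hXint : (interior X).Nonempty)
    (hYne : Y.Nonempty) (hYop : IsOpen Y)
    (hΦc : ContinuousOn (fun p : (EuclideanSpace ℝ (Fin n)) × (EuclideanSpace ℝ (Fin m)) => Φ p.1 p.2) (X ×ˢ Y))
    (f : EuclideanSpace ℝ (Fin n) → EReal) (hf : LowerSemicontinuousOn f X)
    (xs : ℕ → EuclideanSpace ℝ (Fin n)) (xb : EuclideanSpace ℝ (Fin n)) (hxs : ∀ ν, xs ν ∈ X) (hxb : xb ∈ X)
    (hxlim : Tendsto xs atTop (𝓝 xb))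
    (ys : ℕ → EuclideanSpace ℝ (Fin m)) (yb : EuclideanSpace ℝ (Fin m)) (hys : ∀ ν, ys ν ∈ phiSubdiff X Y Φ f (xs ν))
    (hyb : yb ∈ Y) (hylim : Tendsto ys atTop (𝓝 yb)) :
    yb ∈ phiSubdiff X Y Φ f xb := by
  refine ⟨hyb, fun x hx => ?_⟩
  have hx_lim : Tendsto (fun ν => Φ x (ys ν)) atTop (𝓝 (Φ x yb)) :=
    (hΦc (x, yb) ⟨hx, hyb⟩).tendsto.comp (tendsto_nhdsWithin_iff.mpr
      ⟨tendsto_const_nhds.prodMk_nhds hylim, Eventually.of_forall fun ν => ⟨hx, (hys ν).1⟩⟩)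
  have hxs_lim : Tendsto (fun ν => Φ (xs ν) (ys ν)) atTop (𝓝 (Φ xb yb)) :=
    (hΦc (xb, yb) ⟨hxb, hyb⟩).tendsto.comp (tendsto_nhdsWithin_iff.mpr
      ⟨hxlim.prodMk_nhds hylim, Eventually.of_forall fun ν => ⟨hxs ν, (hys ν).1⟩⟩)
  have hxs_within : Tendsto xs atTop (𝓝[X] xb) :=
    tendsto_nhdsWithin_iff.mpr ⟨hxlim, Eventually.of_forall hxs⟩
  rw [← EReal.le_sub_iff_add_le (Or.inl (EReal.coe_ne_bot _)) (Or.inl (EReal.coe_ne_top _))]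
  refine le_of_forall_lt fun a ha => ?_
  obtain ⟨b, hab, hb⟩ := exists_between ha
  refine hab.trans_le ?_
  rw [EReal.le_sub_iff_add_le (Or.inl (EReal.coe_ne_bot _)) (Or.inl (EReal.coe_ne_top _))]
  have hsum : Tendsto (fun ν => b + ((Φ x (ys ν) - Φ (xs ν) (ys ν) : ℝ) : EReal)) atTop
      (𝓝 (b + ((Φ x yb - Φ xb yb : ℝ) : EReal))) :=
    (EReal.continuousAt_add (p := (b, ((Φ x yb - Φ xb yb : ℝ) : EReal)))
      (Or.inr (EReal.coe_ne_bot _)) (Or.inr (EReal.coe_ne_top _))).tendsto.comp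
      (tendsto_const_nhds.prodMk_nhds (EReal.tendsto_coe.mpr (hx_lim.sub hxs_lim)))
  refine le_of_tendsto hsum ?_
  filter_upwards [hxs_within.eventually (hf xb hxb b hb)] with ν hν
  exact (add_le_add_left hν.le _).trans ((hys ν).2 x hx)

end
end

section
/- Let X ⊆ ℝ^n be closed with nonempty interior, Y ⊆ ℝ^m nonempty and open, Φ : X × Y → ℝ continuous relative to X × Y, and let g satisfy Assumption (G). Then the Φ-conjugate g^Φ(y) = sup_{x ∈ X} (Φ(x,y) − g(x)) is continuous on Y. -/
set_option linter.unusedVariables false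

open Filter Topology Metric Set Bornology
open scoped RealInnerProductSpace NNReal

noncomputable section

variable {E F : Type*} [NormedAddCommGroup E] [InnerProductSpace ℝ E] [CompleteSpace E]
  [NormedAddCommGroup F] [InnerProductSpace ℝ F] [CompleteSpace F]

theorem EReal.sub_lt_coe_iff_coe_sub_lt {a c : ℝ} {u : EReal} (hu : u ≠ ⊥) :
    (a : EReal) - u < c ↔ ((a - c : ℝ) : EReal) < u := by
  induction u with
  | bot => exact absurd rfl hu
  | top => simp [-EReal.coe_sub]
  | coe r =>
    norm_cast
    constructor <;> intro h <;> linarith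

theorem EReal.sub_coe_le_neg_coe_iff {a c : ℝ} {u : EReal} (hu : u ≠ ⊥) :
    u - (a : EReal) ≤ ((-c : ℝ) : EReal) ↔ (c : EReal) ≤ (a : EReal) - u := by
  induction u with
  | bot => exact absurd rfl hu
  | top => simp
  | coe r =>
    norm_cast
    constructor <;> intro h <;> linarith

theorem lowerSemicontinuousOn_phiConj {α β : Type*} [TopologicalSpace α] [TopologicalSpace β]
    {X : Set α} {Y : Set β} {Φ : α → β → ℝ} {f : α → EReal}
    (hΦ : ContinuousOn (fun p : α × β => Φ p.1 p.2) (X ×ˢ Y)) :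
    LowerSemicontinuousOn (phiConj X Φ f) Y := by
  intro y hy b hb
  simp only [phiConj, lt_iSup_iff] at hb
  obtain ⟨x, hx, hb⟩ := hb
  have hcont : ContinuousWithinAt (fun y' => (Φ x y' : EReal) - f x) Y y := by
    have hΦx : ContinuousWithinAt (fun y' => Φ x y') Y y :=
      (hΦ (x, y) ⟨hx, hy⟩).comp (f := fun y' => (x, y'))
        (Continuous.prodMk_right x).continuousWithinAt fun _ hy' => ⟨hx, hy'⟩
    have hΦx' : Tendsto (fun y' => (Φ x y' : EReal)) (𝓝[Y] y) (𝓝 (Φ x y : EReal)) :=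
      (continuous_coe_real_ereal.tendsto _).comp hΦx
    simp only [sub_eq_add_neg]
    exact (EReal.continuousAt_add (p := ((Φ x y : EReal), -f x)) (by simp) (by simp)).tendsto.comp
      (hΦx'.prodMk_nhds tendsto_const_nhds)
  filter_upwards [hcont.tendsto.eventually (lt_mem_nhds hb)] with y' hy'
  exact hy'.trans_le (le_iSup₂ (f := fun x _ => (Φ x y' : EReal) - f x) x hx)

theorem eventually_sub_lt_coe {α β : Type*} [TopologicalSpace α] [TopologicalSpace β]
    {X : Set α} {Y : Set β} {Φ : α → β → ℝ} {f : α → EReal}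
    (hΦ : ContinuousOn (fun p : α × β => Φ p.1 p.2) (X ×ˢ Y)) (hf : ∀ x, f x ≠ ⊥)
    (hlsc : LowerSemicontinuousOn f X) {x : α} {y : β} (hx : x ∈ X) (hy : y ∈ Y) {c : ℝ}
    (hc : (Φ x y : EReal) - f x < c) :
    ∀ᶠ p in 𝓝[X ×ˢ Y] (x, y), (Φ p.1 p.2 : EReal) - f p.1 < c := by
  rw [EReal.sub_lt_coe_iff_coe_sub_lt (hf x)] at hc
  obtain ⟨r, hr, hrf⟩ := EReal.lt_iff_exists_real_btwn.1 hc
  have hfst : Tendsto Prod.fst (𝓝[X ×ˢ Y] (x, y)) (𝓝[X] x) := by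
    rw [nhdsWithin_prod_eq]
    exact tendsto_fst
  have hΦr : Φ x y < r + c := by
    have := EReal.coe_lt_coe_iff.1 hr
    linarith
  filter_upwards [hfst.eventually (hlsc x hx r hrf),
    (hΦ (x, y) ⟨hx, hy⟩).tendsto.eventually (gt_mem_nhds hΦr)] with p hfp hΦp
  rw [EReal.sub_lt_coe_iff_coe_sub_lt (hf p.1)]
  exact (EReal.coe_lt_coe_iff.2 (by linarith)).trans hfp

theorem AssumptionG.upperSemicontinuousOn_phiConj {α β : Type*} [NormedAddCommGroup α]
    [NormedAddCommGroup β] [ProperSpace α] {X : Set α} {Y : Set β}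
    {Φ : α → β → ℝ} {g : α → EReal} (hG : AssumptionG X Y Φ g) (hX : IsClosed X)
    (hΦ : ContinuousOn (fun p : α × β => Φ p.1 p.2) (X ×ˢ Y)) :
    UpperSemicontinuousOn (phiConj X Φ g) Y := by
  intro y hy b hb
  obtain ⟨c, hyc, hcb⟩ := EReal.lt_iff_exists_real_btwn.1 hb
  obtain ⟨V, hV, B, hB, hlevel⟩ := hG.levelBounded y hy (-c)
  have hK : IsCompact (closure B ∩ X) := hB.isCompact_closure.inter_right hX
  have hnear : ∀ᶠ y' in 𝓝 y, ∀ x ∈ closure B ∩ X, y' ∈ Y → (Φ x y' : EReal) - g x < c := by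
    refine hK.eventually_forall_of_forall_eventually
      (P := fun y' x => x ∈ X → y' ∈ Y → (Φ x y' : EReal) - g x < c) (fun x hx => ?_) |>.mono
      fun y' h x hx => h x hx hx.2
    have hxc : (Φ x y : EReal) - g x < c :=
      (le_iSup₂ (f := fun x _ => (Φ x y : EReal) - g x) x hx.2).trans_lt hyc
    have h := eventually_nhdsWithin_iff.1 (eventually_sub_lt_coe hΦ hG.ne_bot hG.lsc hx.2 hy hxc)
    filter_upwards [(continuous_swap.tendsto (y, x)).eventually h] with p hp hpX hpY
    exact hp ⟨hpX, hpY⟩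
  filter_upwards [nhdsWithin_le_nhds hnear, nhdsWithin_le_nhds hV, self_mem_nhdsWithin]
    with y' hy' hyV hyY
  refine (iSup₂_le fun x hx => ?_).trans_lt hcb
  by_contra! hlt
  have hxB : x ∈ B :=
    hlevel y' ⟨hyV, hyY⟩ ⟨hx, (EReal.sub_coe_le_neg_coe_iff (hG.ne_bot x)).2 hlt.le⟩
  exact lt_asymm hlt (hy' x ⟨subset_closure hxB, hx⟩ hyY)

theorem phi_conjugate_continuous {n m : ℕ}
    (X : Set (EuclideanSpace ℝ (Fin n))) (Y : Set (EuclideanSpace ℝ (Fin m)))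
    (Φ : EuclideanSpace ℝ (Fin n) → EuclideanSpace ℝ (Fin m) → ℝ)
    (hXcl : IsClosed X) (hXint : (interior X).Nonempty)
    (hYne : Y.Nonempty) (hYop : IsOpen Y)
    (hΦc : ContinuousOn (fun p : (EuclideanSpace ℝ (Fin n)) × (EuclideanSpace ℝ (Fin m)) => Φ p.1 p.2) (X ×ˢ Y))
    (g : EuclideanSpace ℝ (Fin n) → EReal) (hG : AssumptionG X Y Φ g) :
    ContinuousOn (phiConj X Φ g) Y := by
  exact continuousOn_iff_lower_upperSemicontinuousOn.2
    ⟨lowerSemicontinuousOn_phiConj hΦc, hG.upperSemicontinuousOn_phiConj hXcl hΦc⟩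

end
end

section
/- Let X ⊆ ℝ^n be closed with nonempty interior, Y ⊆ ℝ^m nonempty and open, Φ : X × Y → ℝ continuous relative to X × Y, and let g satisfy Assumption (G). Then for any sequence y^ν → y★ with y^ν, y★ ∈ Y and any choice x^ν ∈ (∂_Φ g)^{-1}(y^ν), the sequence {x^ν} is bounded and every cluster point of {x^ν} lies in (∂_Φ g)^{-1}(y★). -/
set_option linter.unusedVariables false

open Filter Topology Metric Set Bornology
open scoped RealInnerProductSpace NNReal

noncomputable section

variable {E F : Type*} [NormedAddCommGroup E] [InnerProductSpace ℝ E] [CompleteSpace E]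
  [NormedAddCommGroup F] [InnerProductSpace ℝ F] [CompleteSpace F]

/-- A value of `g` at a point of the proximal set is at most its value at any competitor, up to
the difference of couplings. -/
theorem le_add_of_mem_proxSet {α β : Type*} {X : Set α} {Φ : α → β → ℝ} {g : α → EReal} {y : β}
    {x x' : α} (hx : x ∈ proxSet X Φ g y) (hx' : x' ∈ X) {r : ℝ} (hr : g x' = r) :
    g x ≤ ((r - Φ x' y + Φ x y : ℝ) : EReal) := by
  have h := hx.2 x' hx'
  rw [hr, ← EReal.coe_sub] at h
  rw [EReal.coe_add]
  exact (EReal.sub_le_iff_le_add (Or.inl (EReal.coe_ne_bot _)) (Or.inl (EReal.coe_ne_top _))).1 h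

theorem prox_outer_semicontinuity {n m : ℕ}
    (X : Set (EuclideanSpace ℝ (Fin n))) (Y : Set (EuclideanSpace ℝ (Fin m)))
    (Φ : EuclideanSpace ℝ (Fin n) → EuclideanSpace ℝ (Fin m) → ℝ)
    (hXcl : IsClosed X) (hXint : (interior X).Nonempty)
    (hYne : Y.Nonempty) (hYop : IsOpen Y)
    (hΦc : ContinuousOn (fun p : (EuclideanSpace ℝ (Fin n)) × (EuclideanSpace ℝ (Fin m)) => Φ p.1 p.2) (X ×ˢ Y))
    (g : EuclideanSpace ℝ (Fin n) → EReal) (hG : AssumptionG X Y Φ g)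
    (ys : ℕ → EuclideanSpace ℝ (Fin m)) (ystar : EuclideanSpace ℝ (Fin m)) (hys : ∀ ν, ys ν ∈ Y) (hystar : ystar ∈ Y)
    (hylim : Tendsto ys atTop (𝓝 ystar))
    (xs : ℕ → EuclideanSpace ℝ (Fin n)) (hxs : ∀ ν, xs ν ∈ proxSet X Φ g (ys ν)) :
    IsBounded (Set.range xs) ∧
    ∀ x, MapClusterPt x atTop xs → x ∈ proxSet X Φ g ystar := by
  have hΦy : ∀ z ∈ X, Tendsto (fun y => Φ z y) (𝓝[Y] ystar) (𝓝 (Φ z ystar)) := fun z hz =>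
    (hΦc.comp (f := fun y => (z, y)) (by fun_prop) (fun y hy => ⟨hz, hy⟩)) ystar hystar
  have hy : Tendsto ys atTop (𝓝[Y] ystar) :=
    tendsto_nhdsWithin_iff.2 ⟨hylim, Eventually.of_forall hys⟩
  constructor
  · obtain ⟨x₀, hx₀, htop⟩ := hG.proper
    lift g x₀ to ℝ using ⟨htop, hG.ne_bot x₀⟩ with r hr
    obtain ⟨V, hV, B, hB, hVB⟩ := hG.levelBounded ystar hystar (r - Φ x₀ ystar + 1)
    have hΦ : ∀ᶠ ν in atTop, Φ x₀ ystar - 1 < Φ x₀ (ys ν) :=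
      ((hΦy x₀ hx₀).comp hy).eventually_const_lt (sub_one_lt _)
    obtain ⟨N, hN⟩ := eventually_atTop.1 (hΦ.and (hylim.eventually_mem hV))
    refine (hB.union ((Set.finite_Iio N).image xs).isBounded).subset ?_
    rintro _ ⟨ν, rfl⟩
    rcases lt_or_ge ν N with h | h
    · exact Or.inr ⟨ν, h, rfl⟩
    · refine Or.inl (hVB (ys ν) ⟨(hN ν h).2, hys ν⟩ ⟨(hxs ν).1, ((hxs ν).2 x₀ hx₀).trans ?_⟩)
      rw [← hr, ← EReal.coe_sub, EReal.coe_le_coe_iff]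
      linarith [(hN ν h).1]
  · intro x hx
    have hxX : x ∈ X := hXcl.mem_of_mapClusterPt hx (Eventually.of_forall fun ν => (hxs ν).1)
    refine ⟨hxX, fun x' hx' => ?_⟩
    by_cases htop : g x' = ⊤
    · simp [htop]
    obtain ⟨r, hr⟩ : ∃ r : ℝ, g x' = r := ⟨_, (EReal.coe_toReal htop (hG.ne_bot x')).symm⟩
    rw [hr, ← EReal.coe_sub,
      EReal.sub_le_iff_le_add (Or.inl (EReal.coe_ne_bot _)) (Or.inl (EReal.coe_ne_top _)),
      ← EReal.coe_add]
    by_contra! hlt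
    obtain ⟨t, hst, htg⟩ := EReal.exists_between_coe_real hlt
    have hprod : Tendsto (fun p : _ × _ => r - Φ x' p.2 + Φ p.1 p.2) (𝓝[X] x ×ˢ 𝓝[Y] ystar)
        (𝓝 (r - Φ x' ystar + Φ x ystar)) := by
      refine (tendsto_const_nhds.sub ((hΦy x' hx').comp tendsto_snd)).add ?_
      rw [← nhdsWithin_prod_eq]
      exact hΦc (x, ystar) ⟨hxX, hystar⟩
    obtain ⟨U, hU, W, hW, hUW⟩ := eventually_prod_iff.1
      (hprod.eventually_lt_const (EReal.coe_lt_coe_iff.1 hst))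
    have hxU : ∃ᶠ ν in atTop, xs ν ∈ X → U (xs ν) ∧ (t : EReal) < g (xs ν) :=
      hx.frequently (eventually_nhdsWithin_iff.1 (hU.and (hG.lsc x hxX t htg)))
    obtain ⟨ν, hν, hWν⟩ := (hxU.and_eventually (hy.eventually hW)).exists
    obtain ⟨hUν, hgν⟩ := hν (hxs ν).1
    exact absurd (le_add_of_mem_proxSet (hxs ν) hx' hr)
      ((EReal.coe_lt_coe_iff.2 (hUW hUν hWν)).trans hgν).not_ge

end
end

section
/- Let X ⊆ ℝ^n be closed with nonempty interior, Y ⊆ ℝ^m nonempty and open, and Φ : X × Y → ℝ continuous relative to X × Y and continuously differentiable on int(X) × Y. Let (x̄, v̄) ∈ gph ∂g with x̄ ∈ int X, a point at which g is locally lower semicontinuous and prox-regular with parameter r > 0, and let ȳ ∈ Y satisfy ∇_x Φ(x̄, ȳ) = v̄. Assume there is a neighborhood of ȳ such that for every y in it, x ↦ −Φ(x, y) is strongly convex with parameter δ ≥ r. Then g is Φ-prox-regular at x̄ for (v̄, ȳ). -/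
set_option linter.unusedVariables false

open Filter Topology Metric Set Bornology
open scoped RealInnerProductSpace NNReal

noncomputable section

variable {E F : Type*} [NormedAddCommGroup E] [InnerProductSpace ℝ E] [CompleteSpace E]
  [NormedAddCommGroup F] [InnerProductSpace ℝ F] [CompleteSpace F]

/-- First-order lower bound for a strongly convex function, at a point where it is
differentiable. -/
theorem StrongConvexOn.add_inner_add_sq_le {s : Set E} {c : ℝ} {f : E → ℝ} {x x' v : E}
    (hf : StrongConvexOn s c f) (hx : x ∈ s) (hx' : x' ∈ s) (hv : HasGradientAt f v x) :
    f x + ⟪v, x' - x⟫ + c / 2 * ‖x' - x‖ ^ 2 ≤ f x' := by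
  have hline : HasDerivAt (fun t : ℝ => x + t • (x' - x)) (x' - x) 0 := by
    simpa using ((hasDerivAt_id (0 : ℝ)).smul_const (x' - x)).const_add x
  have hv' : HasFDerivAt f (InnerProductSpace.toDual ℝ E v) (x + (0 : ℝ) • (x' - x)) := by
    simpa using hv.hasFDerivAt
  have hcomp : HasDerivAt (fun t : ℝ => f (x + t • (x' - x))) ⟪v, x' - x⟫ 0 := by
    simpa [Function.comp_def] using hv'.comp_hasDerivAt 0 hline
  have hslope : Tendsto (slope (fun t : ℝ => f (x + t • (x' - x))) 0) (𝓝[>] 0)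
      (𝓝 ⟪v, x' - x⟫) :=
    (hasDerivAt_iff_tendsto_slope.1 hcomp).mono_left (nhdsWithin_mono _ fun t ht => ne_of_gt ht)
  have hbound : Tendsto (fun t : ℝ => f x' - f x - (1 - t) * (c / 2 * ‖x' - x‖ ^ 2)) (𝓝[>] 0)
      (𝓝 (f x' - f x - (1 - 0) * (c / 2 * ‖x' - x‖ ^ 2))) :=
    Continuous.continuousWithinAt (by fun_prop)
  have hle := le_of_tendsto_of_tendsto hslope hbound (by
    filter_upwards [Ioo_mem_nhdsGT (zero_lt_one' ℝ)] with t ht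
    have hconv := hf.2 hx hx' (sub_nonneg.2 ht.2.le) ht.1.le (by ring)
    have hpt : (1 - t) • x + t • x' = x + t • (x' - x) := by module
    rw [hpt, norm_sub_rev x x'] at hconv
    simp only [smul_eq_mul] at hconv
    rw [slope_def_field, div_le_iff₀ (by simpa using ht.1)]
    simp only [zero_smul, add_zero, sub_zero]
    nlinarith [hconv])
  linarith

theorem phi_prox_regular_of_prox_regular {n m : ℕ}
    (X : Set (EuclideanSpace ℝ (Fin n))) (Y : Set (EuclideanSpace ℝ (Fin m)))
    (Φ : EuclideanSpace ℝ (Fin n) → EuclideanSpace ℝ (Fin m) → ℝ)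
    (hXcl : IsClosed X) (hXint : (interior X).Nonempty)
    (hYne : Y.Nonempty) (hYop : IsOpen Y)
    (hΦc : ContinuousOn (fun p : (EuclideanSpace ℝ (Fin n)) × (EuclideanSpace ℝ (Fin m)) => Φ p.1 p.2) (X ×ˢ Y))
    (hΦd : ContDiffOn ℝ 1 (fun p : (EuclideanSpace ℝ (Fin n)) × (EuclideanSpace ℝ (Fin m)) => Φ p.1 p.2) ((interior X) ×ˢ Y))
    (g : EuclideanSpace ℝ (Fin n) → EReal) (xb vb : EuclideanSpace ℝ (Fin n)) (hxb : xb ∈ interior X)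
    (r : ℝ) (hr : 0 < r) (hpr : ProxRegularAt g xb vb r)
    (yb : EuclideanSpace ℝ (Fin m)) (hyb : yb ∈ Y) (hvb : gradx Φ xb yb = vb)
    (δ : ℝ) (hδ : r ≤ δ)
    (hsc : ∃ U ∈ 𝓝 yb, ∀ y ∈ U, StrongConvexOn X δ (fun x => -Φ x y)) :
    PhiProxRegularAt X Φ g xb vb yb := by
  obtain ⟨h1, h2, hlsc, hsub, ε, hε, hprox⟩ := hpr
  obtain ⟨U, hU, hconv⟩ := hsc
  obtain ⟨a, ha, haX⟩ := Metric.nhds_basis_closedBall.mem_iff.1 (isOpen_interior.mem_nhds hxb)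
  obtain ⟨b, hb, hbU⟩ := Metric.nhds_basis_closedBall.mem_iff.1 (inter_mem hU (hYop.mem_nhds hyb))
  refine ⟨h1, h2, hlsc, hsub, min ε (min a b), lt_min hε (lt_min ha hb), ?_⟩
  intro x x' v y hx' hx hgx hv hvv hy hvy
  have hεab : min ε (min a b) ≤ ε := min_le_left _ _
  have ha' : min ε (min a b) ≤ a := (min_le_right _ _).trans (min_le_left _ _)
  have hb' : min ε (min a b) ≤ b := (min_le_right _ _).trans (min_le_right _ _)
  have hxX : x ∈ interior X := haX (by simpa [dist_eq_norm] using hx.trans ha')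
  have hx'X : x' ∈ interior X := haX (by simpa [dist_eq_norm] using hx'.trans ha')
  have hyU : y ∈ U ∩ Y := hbU (by simpa [dist_eq_norm] using hy.trans hb')
  have hgx' : g x ≤ g xb + ((ε : ℝ) : EReal) := by
    rw [add_comm]
    exact (EReal.sub_le_iff_le_add (Or.inl h2) (Or.inl h1)).1
      (hgx.trans (EReal.coe_le_coe_iff.2 hεab))
  have hdiff : DifferentiableAt ℝ (fun z => Φ z y) x := by
    have hpair := (hΦd.differentiableOn one_ne_zero).differentiableAt
      ((isOpen_interior.prod hYop).mem_nhds (mk_mem_prod hxX hyU.2))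
    exact hpair.fun_comp' x (f := fun z => (z, y)) (by fun_prop)
  have hgrad : HasGradientAt (fun z => -Φ z y) (-v) x := by
    have hΦv : HasGradientAt (fun z => Φ z y) v x := hvy ▸ hdiff.hasGradientAt
    rw [hasGradientAt_iff_hasFDerivAt, map_neg]
    exact hΦv.hasFDerivAt.neg
  have hstrong := (hconv y hyU.1).add_inner_add_sq_le (interior_subset hxX)
    (interior_subset hx'X) hgrad
  refine le_trans ?_ (hprox x x' v (hx'.trans hεab) (hx.trans hεab) hgx' hv (hvv.trans hεab))
  refine add_le_add_right (EReal.coe_le_coe_iff.2 ?_) _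
  rw [inner_neg_left] at hstrong
  have hsq := mul_le_mul_of_nonneg_right hδ (sq_nonneg ‖x' - x‖)
  linarith
end
end

section
/- Let X ⊆ ℝ^n be closed with nonempty interior, Y ⊆ ℝ^m nonempty and open, Φ : X × Y → ℝ continuous relative to X × Y and continuously differentiable on int(X) × Y, and let g satisfy Assumption (G). Suppose g is finite at x̄ ∈ int X and (∂_Φ g)^{-1}(ȳ) = {x̄} for some ȳ ∈ Y, and set v̄ := ∇_x Φ(x̄, ȳ). Then v̄ ∈ ∂g(x̄), and the following are equivalent: (i) g is Φ-prox-regular at x̄ for (v̄, ȳ) with the Φ-prox-regularity inequality holding strictly for x' ≠ x with x', x near x̄ and y near ȳ; (ii) there is ε > 0 such that for all (x, y), (x', y') near (x̄, ȳ) with x ≠ x', ∇_x Φ(x, y) ∈ T_ε(x) and ∇_x Φ(x', y') ∈ T_ε(x'), one has 0 > Φ(x', y) − Φ(x, y) + Φ(x, y') − Φ(x', y'); (iii) there is ε > 0 such that (∂_Φ g)^{-1} is single-valued in a neighborhood of ȳ and for each y in that neighborhood, (∂_Φ g)^{-1}(y) = {x ∈ X : ∇_x Φ(x, y) ∈ T_ε(x)}.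 Here T_ε is a g-attentive ε-localization of ∂g at x̄ for v̄. -/
set_option linter.unusedVariables false

open Filter Topology Metric Set Bornology
open scoped RealInnerProductSpace NNReal

noncomputable section

variable {E F : Type*} [NormedAddCommGroup E] [InnerProductSpace ℝ E] [CompleteSpace E]
  [NormedAddCommGroup F] [InnerProductSpace ℝ F] [CompleteSpace F]

set_option linter.unusedSectionVars false

/-- The objective of the generalized proximal mapping is jointly lower semicontinuous. -/
lemma lowerSemicontinuousOn_sub_coupling {X : Set E} {Y : Set F} {Φ : E → F → ℝ} {g : E → EReal}
    (hΦc : ContinuousOn (fun p : E × F => Φ p.1 p.2) (X ×ˢ Y)) (hg : LowerSemicontinuousOn g X) :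
    LowerSemicontinuousOn (fun p : E × F => g p.1 - ((Φ p.1 p.2 : ℝ) : EReal)) (X ×ˢ Y) := by
  have h1 : LowerSemicontinuousOn (fun p : E × F => g p.1) (X ×ˢ Y) := by
    intro p hp c hc
    have : Tendsto (Prod.fst : E × F → E) (𝓝[X ×ˢ Y] p) (𝓝[X] p.1) :=
      continuous_fst.continuousAt.continuousWithinAt.tendsto_nhdsWithin fun q hq => hq.1
    exact this.eventually (hg p.1 hp.1 c hc)
  have h2 : ContinuousOn (fun p : E × F => ((-Φ p.1 p.2 : ℝ) : EReal)) (X ×ˢ Y) :=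
    continuous_coe_real_ereal.comp_continuousOn hΦc.neg
  have h3 := h1.add' h2.lowerSemicontinuousOn fun p _ =>
    EReal.continuousAt_add (Or.inr (EReal.coe_ne_bot _)) (Or.inr (EReal.coe_ne_top _))
  simpa only [EReal.coe_neg, ← sub_eq_add_neg] using h3

/-- Membership in the generalized proximal mapping as a global support inequality. -/
lemma mem_proxSet_iff {X : Set E} {Φ : E → F → ℝ} {g : E → EReal} {x : E} {y : F} :
    x ∈ proxSet X Φ g y ↔
      x ∈ X ∧ ∀ x' ∈ X, g x + ((Φ x' y - Φ x y : ℝ) : EReal) ≤ g x' := by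
  refine and_congr_right fun _ => forall₂_congr fun x' _ => ?_
  induction g x <;> induction g x' <;>
    simp only [← EReal.coe_sub, ← EReal.coe_add, EReal.coe_le_coe_iff, EReal.top_sub_coe,
      EReal.bot_sub, EReal.top_add_coe, EReal.bot_add, le_top, bot_le, top_le_iff, le_bot_iff,
      EReal.coe_ne_top, EReal.coe_ne_bot]
  constructor <;> intro h <;> linarith

lemma ne_top_of_mem_proxSet {X : Set E} {Y : Set F} {Φ : E → F → ℝ} {g : E → EReal}
    (hG : AssumptionG X Y Φ g) {x : E} {y : F} (hx : x ∈ proxSet X Φ g y) : g x ≠ ⊤ := by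
  obtain ⟨z, hz, hzt⟩ := hG.proper
  intro h
  have := (mem_proxSet_iff.1 hx).2 z hz
  rw [h, EReal.top_add_coe, top_le_iff] at this
  exact hzt this

/-- The generalized proximal mapping is nonempty-valued on `Y`. -/
lemma proxSet_nonempty [ProperSpace E] {X : Set E} {Y : Set F} {Φ : E → F → ℝ} {g : E → EReal}
    (hX : IsClosed X) (hΦc : ContinuousOn (fun p : E × F => Φ p.1 p.2) (X ×ˢ Y))
    (hG : AssumptionG X Y Φ g) {y : F} (hy : y ∈ Y) : (proxSet X Φ g y).Nonempty := by
  obtain ⟨z, hz, hzt⟩ := hG.proper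
  lift g z to ℝ using ⟨hzt, hG.ne_bot z⟩ with a ha
  obtain ⟨V, hV, B, hB, hVB⟩ := hG.levelBounded y hy (a - Φ z y)
  have hyB := hVB y ⟨mem_of_mem_nhds hV, hy⟩
  have hzB : z ∈ B := hyB ⟨hz, by rw [← ha, ← EReal.coe_sub]⟩
  have hK : IsCompact (X ∩ closure B) := hB.isCompact_closure.inter_left hX
  have hlsc : LowerSemicontinuousOn (fun x => g x - ((Φ x y : ℝ) : EReal)) (X ∩ closure B) := by
    intro x hx c hc
    have : Tendsto (fun x => (x, y)) (𝓝[X ∩ closure B] x) (𝓝[X ×ˢ Y] (x, y)) :=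
      ContinuousWithinAt.tendsto_nhdsWithin (by fun_prop) fun q hq => ⟨hq.1, hy⟩
    exact this.eventually (lowerSemicontinuousOn_sub_coupling hΦc hG.lsc (x, y) ⟨hx.1, hy⟩ c hc)
  obtain ⟨w, hw, hmin⟩ := LowerSemicontinuousOn.exists_isMinOn
    (s := X ∩ closure B) ⟨z, hz, subset_closure hzB⟩ hK hlsc
  refine ⟨w, hw.1, fun x hx => ?_⟩
  rcases le_or_gt (g x - ((Φ x y : ℝ) : EReal)) ((a - Φ z y : ℝ) : EReal) with h | h
  · exact hmin ⟨hx, subset_closure (hyB ⟨hx, h⟩)⟩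
  · refine le_trans (hmin ⟨hz, subset_closure hzB⟩) ?_
    simpa only [← ha, ← EReal.coe_sub] using h.le

/-- If the generalized proximal mapping is single-valued at `yb`, then its values at nearby `y`
are close to the value at `yb`. -/
lemma eventually_proxSet_subset [ProperSpace E] {X : Set E} {Y : Set F} {Φ : E → F → ℝ}
    {g : E → EReal} (hX : IsClosed X) (hY : IsOpen Y)
    (hΦc : ContinuousOn (fun p : E × F => Φ p.1 p.2) (X ×ˢ Y))
    (hG : AssumptionG X Y Φ g) {xb : E} {yb : F} (hyb : yb ∈ Y)
    (hprox : proxSet X Φ g yb = {xb}) {W : Set E} (hW : W ∈ 𝓝 xb) :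
    ∀ᶠ y in 𝓝 yb, proxSet X Φ g y ⊆ W := by
  have hmem : xb ∈ proxSet X Φ g yb := by rw [hprox]; rfl
  have hcont : ContinuousAt (fun y => Φ xb y) yb :=
    ((hΦc.comp (f := fun y : F => (xb, y)) (s := Y) (by fun_prop)
      fun y hy => ⟨hmem.1, hy⟩) yb hyb).continuousAt (hY.mem_nhds hyb)
  obtain ⟨a, ha⟩ : ∃ a : ℝ, (a : EReal) = g xb :=
    ⟨_, EReal.coe_toReal (ne_top_of_mem_proxSet hG hmem) (hG.ne_bot xb)⟩
  have hlt : ∀ c : ℝ, a - Φ xb yb < c → ∀ᶠ y in 𝓝 yb, a - Φ xb y < c := fun c hc =>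
    (continuousAt_const.sub hcont).eventually (gt_mem_nhds hc)
  obtain ⟨V, hV, B, hB, hVB⟩ := hG.levelBounded yb hyb (a - Φ xb yb + 1)
  have hK : IsCompact ((X ∩ closure B) \ interior W) :=
    (hB.isCompact_closure.inter_left hX).diff isOpen_interior
  have key : ∀ᶠ y in 𝓝 yb, ∀ x ∈ (X ∩ closure B) \ interior W, x ∈ X → y ∈ Y →
      g xb - ((Φ xb y : ℝ) : EReal) < g x - ((Φ x y : ℝ) : EReal) := by
    refine hK.eventually_forall_of_forall_eventually fun x hx => ?_
    have hne : x ∉ proxSet X Φ g yb := by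
      rw [hprox]
      rintro rfl
      exact hx.2 (mem_interior_iff_mem_nhds.2 hW)
    have hx' : ((a - Φ xb yb : ℝ) : EReal) < g x - ((Φ x yb : ℝ) : EReal) := by
      by_contra! h
      refine hne ⟨hx.1.1, fun x' hx' => h.trans ?_⟩
      simpa only [← ha, ← EReal.coe_sub] using hmem.2 x' hx'
    obtain ⟨c, hc1, hc2⟩ := EReal.lt_iff_exists_real_btwn.1 hx'
    have h1 := eventually_nhdsWithin_iff.1
      (lowerSemicontinuousOn_sub_coupling hΦc hG.lsc (x, yb) ⟨hx.1.1, hyb⟩ c hc2)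
    have h2 := (continuous_fst.tendsto (yb, x)).eventually (hlt c (EReal.coe_lt_coe_iff.1 hc1))
    filter_upwards [(continuous_swap.tendsto (yb, x)).eventually h1, h2] with p hp1 hp2 hpX hpY
    rw [← ha, ← EReal.coe_sub]
    exact (EReal.coe_lt_coe_iff.2 hp2).trans (hp1 ⟨hpX, hpY⟩)
  filter_upwards [key, hV, hY.mem_nhds hyb, hlt _ (lt_add_one _)] with y hy hyV hyY hy1 x hx
  by_contra hxW
  have hle := hx.2 xb hmem.1
  have hxB : x ∈ B := by
    refine hVB y ⟨hyV, hyY⟩ ⟨hx.1, hle.trans ?_⟩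
    rw [← ha, ← EReal.coe_sub]
    exact EReal.coe_le_coe_iff.2 hy1.le
  exact (hy x ⟨⟨hx.1, subset_closure hxB⟩, fun h => hxW (interior_subset h)⟩ hx.1 hyY).not_ge hle

section Gradient

variable {X : Set E} {Y : Set F} {Φ : E → F → ℝ}

lemma hasGradientAt_gradx (hY : IsOpen Y)
    (hΦd : ContDiffOn ℝ 1 (fun p : E × F => Φ p.1 p.2) (interior X ×ˢ Y)) {x : E} {y : F}
    (hx : x ∈ interior X) (hy : y ∈ Y) :
    HasGradientAt (fun x' => Φ x' y) (gradx Φ x y) x := by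
  have hd : DifferentiableAt ℝ (fun p : E × F => Φ p.1 p.2) (x, y) :=
    ((hΦd (x, y) ⟨hx, hy⟩).contDiffAt
      ((isOpen_interior.prod hY).mem_nhds ⟨hx, hy⟩)).differentiableAt one_ne_zero
  have : DifferentiableAt ℝ (fun x' => Φ x' y) x :=
    hd.comp (f := fun x' : E => (x', y)) x (by fun_prop)
  exact this.hasGradientAt

lemma continuousAt_gradx (hY : IsOpen Y)
    (hΦd : ContDiffOn ℝ 1 (fun p : E × F => Φ p.1 p.2) (interior X ×ˢ Y)) {x : E} {y : F}
    (hx : x ∈ interior X) (hy : y ∈ Y) :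
    ContinuousAt (fun p : E × F => gradx Φ p.1 p.2) (x, y) := by
  have hO : IsOpen (interior X ×ˢ Y) := isOpen_interior.prod hY
  have hf : ContinuousAt (fderiv ℝ fun p : E × F => Φ p.1 p.2) (x, y) :=
    (hΦd.continuousOn_fderiv_of_isOpen hO le_rfl).continuousAt (hO.mem_nhds ⟨hx, hy⟩)
  have hcomp : ContinuousAt (fun p : E × F => (InnerProductSpace.toDual ℝ E).symm
      ((fderiv ℝ (fun p : E × F => Φ p.1 p.2) p).comp (ContinuousLinearMap.inl ℝ E F))) (x, y) :=
    (InnerProductSpace.toDual ℝ E).symm.continuous.continuousAt.comp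
      (hf.clm_comp continuousAt_const)
  refine hcomp.congr ?_
  filter_upwards [hO.mem_nhds ⟨hx, hy⟩] with p hp
  have hd : HasFDerivAt (fun p : E × F => Φ p.1 p.2) _ (p.1, p.2) :=
    (((hΦd p hp).contDiffAt (hO.mem_nhds hp)).differentiableAt one_ne_zero).hasFDerivAt
  have := (hd.comp p.1 (hasFDerivAt_prodMk_left (𝕜 := ℝ) p.1 p.2)).fderiv
  simp only [gradx, gradient]
  rw [← this]
  rfl

/-- At a point of the generalized proximal mapping, the gradient of the coupling is a regular
subgradient. -/
lemma isFSubgrad_gradx (hY : IsOpen Y)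
    (hΦd : ContDiffOn ℝ 1 (fun p : E × F => Φ p.1 p.2) (interior X ×ˢ Y)) {g : E → EReal}
    (hG : AssumptionG X Y Φ g) {x : E} {y : F} (hy : y ∈ Y) (hx : x ∈ proxSet X Φ g y) :
    IsFSubgrad g x (gradx Φ x y) := by
  have hxi := hG.ran_interior y hy hx
  refine ⟨ne_top_of_mem_proxSet hG hx, hG.ne_bot x, fun ε hε => ?_⟩
  have hgrad := (hasGradientAt_iff_isLittleO.1 (hasGradientAt_gradx hY hΦd hxi hy)).def hε
  obtain ⟨δ, hδ, h⟩ :=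
    Metric.eventually_nhds_iff.1 (hgrad.and (mem_interior_iff_mem_nhds.1 hxi))
  refine ⟨δ, hδ, fun x' hx' => ?_⟩
  obtain ⟨h1, h2⟩ := h (by rwa [dist_eq_norm] : dist x' x < δ)
  refine le_trans ?_ ((mem_proxSet_iff.1 hx).2 x' h2)
  refine add_le_add_right (EReal.coe_le_coe_iff.2 ?_) _
  rw [Real.norm_eq_abs] at h1
  linarith [(abs_le.1 h1).1]

end Gradient

lemma IsFSubgrad.isLSubgrad {f : E → EReal} {x v : E} (h : IsFSubgrad f x v) :
    IsLSubgrad f x v :=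
  ⟨h.1, h.2.1, fun _ => x, fun _ => v, tendsto_const_nhds, tendsto_const_nhds,
    tendsto_const_nhds, fun _ => h⟩

/-- For `y` near `yb`, points of the generalized proximal mapping are caught by the
`g`-attentive localization. -/
lemma eventually_proxSet_subset_gAttentiveLoc [ProperSpace E] {X : Set E} {Y : Set F}
    {Φ : E → F → ℝ} {g : E → EReal} (hX : IsClosed X) (hY : IsOpen Y)
    (hΦc : ContinuousOn (fun p : E × F => Φ p.1 p.2) (X ×ˢ Y))
    (hΦd : ContDiffOn ℝ 1 (fun p : E × F => Φ p.1 p.2) (interior X ×ˢ Y))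
    (hG : AssumptionG X Y Φ g) {xb : E} {yb : F} (hyb : yb ∈ Y)
    (hprox : proxSet X Φ g yb = {xb}) {ε : ℝ} (hε : 0 < ε) :
    ∀ᶠ y in 𝓝 yb, proxSet X Φ g y ⊆
      {x | x ∈ X ∧ gradx Φ x y ∈ gAttentiveLoc g xb (gradx Φ xb yb) ε x} := by
  have hmem : xb ∈ proxSet X Φ g yb := by rw [hprox]; rfl
  have hxi := hG.ran_interior yb hyb hmem
  have hO : interior X ×ˢ Y ∈ 𝓝 (xb, yb) :=
    (isOpen_interior.prod hY).mem_nhds ⟨hxi, hyb⟩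
  have hcont : ContinuousAt (fun p : E × F => Φ p.1 p.2) (xb, yb) :=
    hΦd.continuousOn.continuousAt hO
  have hdiff : ContinuousAt (fun p : E × F => Φ xb p.2 - Φ p.1 p.2) (xb, yb) :=
    (ContinuousAt.comp (f := fun p : E × F => (xb, p.2)) (x := (xb, yb)) hcont
      (by fun_prop)).sub hcont
  have h1 : ∀ᶠ p : E × F in 𝓝 (xb, yb), -ε < Φ xb p.2 - Φ p.1 p.2 :=
    hdiff.eventually (lt_mem_nhds (by simpa using hε))
  have h2 : ∀ᶠ p : E × F in 𝓝 (xb, yb), gradx Φ p.1 p.2 ∈ ball (gradx Φ xb yb) ε :=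
    (continuousAt_gradx hY hΦd hxi hyb).eventually (ball_mem_nhds _ hε)
  have h3 : ∀ᶠ p : E × F in 𝓝 (xb, yb), p.1 ∈ ball xb ε :=
    continuous_fst.continuousAt.eventually (ball_mem_nhds _ hε)
  obtain ⟨W, hW, V, hV, hWV⟩ := mem_nhds_prod_iff.1 (h1.and (h2.and h3))
  filter_upwards [eventually_proxSet_subset hX hY hΦc hG hyb hprox hW, hV, hY.mem_nhds hyb]
    with y hyW hyV hyY x hx
  obtain ⟨q1, q2, q3⟩ := hWV (mk_mem_prod (hyW hx) hyV)
  refine ⟨hx.1, mem_ball_iff_norm.1 q3, ?_, (isFSubgrad_gradx hY hΦd hG hyY hx).isLSubgrad,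
    mem_ball_iff_norm.1 q2⟩
  have hle := (mem_proxSet_iff.1 hx).2 xb hmem.1
  lift g x to ℝ using ⟨ne_top_of_mem_proxSet hG hx, hG.ne_bot x⟩ with a
  lift g xb to ℝ using ⟨ne_top_of_mem_proxSet hG hmem, hG.ne_bot xb⟩ with b
  norm_cast at hle ⊢
  linarith

/-- Lower semicontinuity on a set gives local lower semicontinuity at its interior points. -/
lemma LowerSemicontinuousOn.locallyLscAt {X : Set E} {g : E → EReal}
    (hg : LowerSemicontinuousOn g X) {xb : E} (hxb : xb ∈ interior X) : LocallyLscAt g xb := by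
  obtain ⟨ε, hε, hsub⟩ := Metric.nhds_basis_closedBall.mem_iff.1 (mem_interior_iff_mem_nhds.1 hxb)
  refine ⟨ε, hε, fun α _ => ?_⟩
  obtain ⟨v, hv, h⟩ := lowerSemicontinuousOn_iff_preimage_Iic.1 (hg.mono hsub) α
  have : {x | x ∈ closedBall xb ε ∧ g x ≤ α} = closedBall xb ε ∩ v := by
    rw [← h]; rfl
  rw [this]
  exact isClosed_closedBall.inter hv

lemma gAttentiveLoc_mono {g : E → EReal} {xb vb : E} {ε ε' : ℝ} (h : ε ≤ ε') (x : E) :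
    gAttentiveLoc g xb vb ε x ⊆ gAttentiveLoc g xb vb ε' x := by
  rintro v ⟨h1, h2, h3, h4⟩
  refine ⟨h1.trans_le h, h2.trans_le ?_, h3, h4.trans_le h⟩
  gcongr

/-- A point of a single-valued generalized proximal mapping satisfies the strict support
inequality. -/
lemma lt_of_proxSet_eq_singleton {X : Set E} {Y : Set F} {Φ : E → F → ℝ} {g : E → EReal}
    (hG : AssumptionG X Y Φ g) {x x' : E} {y : F} (hx : proxSet X Φ g y = {x}) (hx' : x' ∈ X)
    (hne : x' ≠ x) : g x + ((Φ x' y - Φ x y : ℝ) : EReal) < g x' := by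
  have hmem : x ∈ proxSet X Φ g y := by rw [hx]; rfl
  by_contra! h
  refine hne (hx.subset (mem_proxSet_iff.2 ⟨hx', fun z hz => ?_⟩))
  have hz' := (mem_proxSet_iff.1 hmem).2 z hz
  refine le_trans ?_ hz'
  have hxt := ne_top_of_mem_proxSet hG hmem
  lift g x to ℝ using ⟨hxt, hG.ne_bot x⟩ with a
  have hxt' : g x' ≠ ⊤ := fun ht => by
    rw [ht, top_le_iff, ← EReal.coe_add] at h
    exact EReal.coe_ne_top _ h
  lift g x' to ℝ using ⟨hxt', hG.ne_bot x'⟩ with b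
  norm_cast at h ⊢
  linarith

/-- Adding two strict support inequalities at finite values. -/
lemma coupling_neg_of_support_lt {Φ : E → F → ℝ} {g : E → EReal} {x x' : E} {y y' : F}
    (hx : g x ≠ ⊤ ∧ g x ≠ ⊥) (hx' : g x' ≠ ⊤ ∧ g x' ≠ ⊥)
    (h : g x + ((Φ x' y - Φ x y : ℝ) : EReal) < g x')
    (h' : g x' + ((Φ x y' - Φ x' y' : ℝ) : EReal) < g x) :
    Φ x' y - Φ x y + Φ x y' - Φ x' y' < 0 := by
  lift g x to ℝ using hx with a
  lift g x' to ℝ using hx' with b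
  norm_cast at h h'
  linarith

theorem phi_prox_regularity_equivalences {n m : ℕ}
    (X : Set (EuclideanSpace ℝ (Fin n))) (Y : Set (EuclideanSpace ℝ (Fin m)))
    (Φ : EuclideanSpace ℝ (Fin n) → EuclideanSpace ℝ (Fin m) → ℝ)
    (hXcl : IsClosed X) (hXint : (interior X).Nonempty)
    (hYne : Y.Nonempty) (hYop : IsOpen Y)
    (hΦc : ContinuousOn (fun p : (EuclideanSpace ℝ (Fin n)) × (EuclideanSpace ℝ (Fin m)) => Φ p.1 p.2) (X ×ˢ Y))
    (hΦd : ContDiffOn ℝ 1 (fun p : (EuclideanSpace ℝ (Fin n)) × (EuclideanSpace ℝ (Fin m)) => Φ p.1 p.2) ((interior X) ×ˢ Y))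
    (g : EuclideanSpace ℝ (Fin n) → EReal) (hG : AssumptionG X Y Φ g)
    (xb : EuclideanSpace ℝ (Fin n)) (hxb : xb ∈ interior X) (hfin : g xb ≠ ⊤ ∧ g xb ≠ ⊥)
    (yb : EuclideanSpace ℝ (Fin m)) (hyb : yb ∈ Y) (hprox : proxSet X Φ g yb = {xb})
    (vb : EuclideanSpace ℝ (Fin n)) (hvb : vb = gradx Φ xb yb) :
    IsLSubgrad g xb vb ∧
    (PhiProxRegularStrictAt X Φ g xb vb yb ↔
      (∃ ε > (0 : ℝ), ∃ δ > (0 : ℝ), ∀ (x x' : EuclideanSpace ℝ (Fin n)) (y y' : EuclideanSpace ℝ (Fin m)),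
        ‖x - xb‖ < δ → ‖y - yb‖ < δ → ‖x' - xb‖ < δ → ‖y' - yb‖ < δ → x ≠ x' →
        gradx Φ x y ∈ gAttentiveLoc g xb vb ε x →
        gradx Φ x' y' ∈ gAttentiveLoc g xb vb ε x' →
        Φ x' y - Φ x y + Φ x y' - Φ x' y' < 0)) ∧
    ((∃ ε > (0 : ℝ), ∃ δ > (0 : ℝ), ∀ (x x' : EuclideanSpace ℝ (Fin n)) (y y' : EuclideanSpace ℝ (Fin m)),
        ‖x - xb‖ < δ → ‖y - yb‖ < δ → ‖x' - xb‖ < δ → ‖y' - yb‖ < δ → x ≠ x' →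
        gradx Φ x y ∈ gAttentiveLoc g xb vb ε x →
        gradx Φ x' y' ∈ gAttentiveLoc g xb vb ε x' →
        Φ x' y - Φ x y + Φ x y' - Φ x' y' < 0) ↔
      (∃ ε > (0 : ℝ), ∃ U ∈ 𝓝 yb, ∀ y ∈ U,
        (∃ x, proxSet X Φ g y = {x}) ∧
        proxSet X Φ g y = {x | x ∈ X ∧ gradx Φ x y ∈ gAttentiveLoc g xb vb ε x})) := by
  subst hvb
  have hmem : xb ∈ proxSet X Φ g yb := by rw [hprox]; rfl
  have hsub : IsLSubgrad g xb (gradx Φ xb yb) :=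
    (isFSubgrad_gradx hYop hΦd hG hyb hmem).isLSubgrad
  refine ⟨hsub, ?_⟩
  have mono_to_single : (∃ ε > (0 : ℝ), ∃ δ > (0 : ℝ),
      ∀ (x x' : EuclideanSpace ℝ (Fin n)) (y y' : EuclideanSpace ℝ (Fin m)),
        ‖x - xb‖ < δ → ‖y - yb‖ < δ → ‖x' - xb‖ < δ → ‖y' - yb‖ < δ → x ≠ x' →
        gradx Φ x y ∈ gAttentiveLoc g xb (gradx Φ xb yb) ε x →
        gradx Φ x' y' ∈ gAttentiveLoc g xb (gradx Φ xb yb) ε x' →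
        Φ x' y - Φ x y + Φ x y' - Φ x' y' < 0) →
      ∃ ε > (0 : ℝ), ∃ U ∈ 𝓝 yb, ∀ y ∈ U, (∃ x, proxSet X Φ g y = {x}) ∧
        proxSet X Φ g y =
          {x | x ∈ X ∧ gradx Φ x y ∈ gAttentiveLoc g xb (gradx Φ xb yb) ε x} := by
    rintro ⟨ε, hε, δ, hδ, h⟩
    have hpos : 0 < min ε δ := lt_min hε hδ
    refine ⟨min ε δ, hpos, _, Filter.inter_mem (Filter.inter_mem (hYop.mem_nhds hyb)
      (ball_mem_nhds yb hδ)) (eventually_proxSet_subset_gAttentiveLoc hXcl hYop hΦc hΦd hG hyb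
        hprox hpos), ?_⟩
    rintro y ⟨⟨hyY, hyδ⟩, hyS⟩
    rw [mem_ball_iff_norm] at hyδ
    obtain ⟨x, hx⟩ := proxSet_nonempty hXcl hΦc hG hyY
    have huniq : {x | x ∈ X ∧ gradx Φ x y ∈
        gAttentiveLoc g xb (gradx Φ xb yb) (min ε δ) x} ⊆ {x} := by
      rintro x' ⟨-, hx'⟩
      by_contra hne
      have hxT := (hyS hx).2
      have := h x x' y y (hxT.1.trans_le (min_le_right _ _)) hyδ
        (hx'.1.trans_le (min_le_right _ _)) hyδ (Ne.symm hne)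
        (gAttentiveLoc_mono (min_le_left _ _) _ hxT) (gAttentiveLoc_mono (min_le_left _ _) _ hx')
      linarith
    have hsing : proxSet X Φ g y = {x} :=
      Subset.antisymm (hyS.trans huniq) (singleton_subset_iff.2 hx)
    exact ⟨⟨x, hsing⟩, Subset.antisymm hyS (huniq.trans hsing.ge)⟩
  refine ⟨⟨?_, fun hmono => ?_⟩, mono_to_single, ?_⟩
  · rintro ⟨-, ε, hε, h⟩
    have hlt : ∀ (x x' : EuclideanSpace ℝ (Fin n)) (y : EuclideanSpace ℝ (Fin m)),
        ‖y - yb‖ < ε → ‖x' - xb‖ < ε → x' ≠ x →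
        gradx Φ x y ∈ gAttentiveLoc g xb (gradx Φ xb yb) ε x →
        g x + ((Φ x' y - Φ x y : ℝ) : EReal) < g x' := by
      rintro x x' y hy hx' hne ⟨h1, h2, h3, h4⟩
      refine h x x' _ y hx'.le h1.le ?_ h3 h4.le hy.le rfl hne
      exact EReal.sub_le_of_le_add' h2.le
    refine ⟨ε, hε, ε, hε, fun x x' y y' hx hy hx' hy' hne hT hT' => ?_⟩
    exact coupling_neg_of_support_lt ⟨hT.2.2.1.1, hT.2.2.1.2.1⟩ ⟨hT'.2.2.1.1, hT'.2.2.1.2.1⟩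
      (hlt x x' y hy hx' hne.symm hT) (hlt x' x y' hy' hx hne hT')
  · obtain ⟨ε, hε, U, hU, h⟩ := mono_to_single hmono
    obtain ⟨r, hr, hrX⟩ := Metric.mem_nhds_iff.1 (mem_interior_iff_mem_nhds.1 hxb)
    obtain ⟨s, hs, hsU⟩ := Metric.mem_nhds_iff.1 hU
    obtain ⟨η, hη, hη'⟩ := exists_between (lt_min hε (lt_min hr hs))
    obtain ⟨hηε, hηr, hηs⟩ : η < ε ∧ η < r ∧ η < s := by simpa only [lt_min_iff] using hη'
    have key : ∀ (x x' v : EuclideanSpace ℝ (Fin n)) (y : EuclideanSpace ℝ (Fin m)),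
        ‖x' - xb‖ ≤ η → ‖x - xb‖ ≤ η → g x - g xb ≤ ((η : ℝ) : EReal) → IsLSubgrad g x v →
        ‖v - gradx Φ xb yb‖ ≤ η → ‖y - yb‖ ≤ η → v = gradx Φ x y →
        x' ∈ X ∧ proxSet X Φ g y = {x} := by
      rintro x x' v y hx' hx hgx hv hvb hy rfl
      refine ⟨hrX (mem_ball_iff_norm.2 (hx'.trans_lt hηr)), ?_⟩
      obtain ⟨⟨z, hz⟩, hS⟩ := h y (hsU (mem_ball_iff_norm.2 (hy.trans_lt hηs)))
      have hxz : x ∈ proxSet X Φ g y := by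
        rw [hS]
        refine ⟨hrX (mem_ball_iff_norm.2 (hx.trans_lt hηr)), hx.trans_lt hηε, ?_, hv,
          hvb.trans_lt hηε⟩
        lift g x to ℝ using ⟨hv.1, hv.2.1⟩ with a
        lift g xb to ℝ using hfin with b
        norm_cast at hgx ⊢
        linarith
      rw [hz] at hxz ⊢
      rw [hxz]
    refine ⟨⟨hfin.1, hfin.2, hG.lsc.locallyLscAt hxb, hsub, η, hη, ?_⟩, η, hη, ?_⟩
    · intro x x' v y hx' hx hgx hv hvb hy hvx
      obtain ⟨hX', hS⟩ := key x x' v y hx' hx hgx hv hvb hy hvx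
      exact (mem_proxSet_iff.1 (hS.ge rfl)).2 x' hX'
    · intro x x' v y hx' hx hgx hv hvb hy hvx hne
      obtain ⟨hX', hS⟩ := key x x' v y hx' hx hgx hv hvb hy hvx
      exact lt_of_proxSet_eq_singleton hG hS hX' hne
  · rintro ⟨ε, hε, U, hU, h⟩
    obtain ⟨r, hr, hrX⟩ := Metric.mem_nhds_iff.1 (mem_interior_iff_mem_nhds.1 hxb)
    obtain ⟨s, hs, hsU⟩ := Metric.mem_nhds_iff.1 hU
    have key : ∀ (x : EuclideanSpace ℝ (Fin n)) (y : EuclideanSpace ℝ (Fin m)),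
        ‖x - xb‖ < min r s → ‖y - yb‖ < min r s →
        gradx Φ x y ∈ gAttentiveLoc g xb (gradx Φ xb yb) ε x →
        x ∈ X ∧ proxSet X Φ g y = {x} := by
      intro x y hx hy hT
      have hxX : x ∈ X := hrX (mem_ball_iff_norm.2 (hx.trans_le (min_le_left _ _)))
      obtain ⟨⟨z, hz⟩, hS⟩ := h y (hsU (mem_ball_iff_norm.2 (hy.trans_le (min_le_right _ _))))
      have hxz : x ∈ proxSet X Φ g y := by
        rw [hS]
        exact ⟨hxX, hT⟩
      rw [hz] at hxz ⊢
      exact ⟨hxX, by rw [hxz]⟩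
    refine ⟨ε, hε, min r s, lt_min hr hs, fun x x' y y' hx hy hx' hy' hne hT hT' => ?_⟩
    obtain ⟨hxX, hS⟩ := key x y hx hy hT
    obtain ⟨hxX', hS'⟩ := key x' y' hx' hy' hT'
    exact coupling_neg_of_support_lt ⟨hT.2.2.1.1, hT.2.2.1.2.1⟩ ⟨hT'.2.2.1.1, hT'.2.2.1.2.1⟩
      (lt_of_proxSet_eq_singleton hG hS hxX' hne.symm)
      (lt_of_proxSet_eq_singleton hG hS' hxX hne)

end
end
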